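/- Let P_X and Q_X be probability distributions on a finite index set X and let P_Y be a probability distribution on a finite index set Y (all with nonnegative entries summing to 1). For the product (joint) distributions on X × Y given by (P_X ⊗ P_Y)(x,y) = P_X(x)·P_Y(y) and (Q_X ⊗ P_Y)(x,y) = Q_X(x)·P_Y(y), one has DL(P_X ⊗ P_Y, Q_X ⊗ P_Y) = DL(P_X, Q_X). -/

import Mathlib

open Real Finset

/-- lit(p,q) = |p(1 - log p) - q(1 - log q)|, natural log, with 0*log 0 = 0
(automatic since Real.log 0 = 0). -/
noncomputable def lit (p q : ℝ) : ℝ :=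
  |p * (1 - Real.log p) - q * (1 - Real.log q)|

/-- δh(p,q) = |p²(1 - 2 log p) - q²(1 - 2 log q)| / (2(p+q)), with δh(0,0) = 0
(automatic since division by zero is 0 in Lean). -/
noncomputable def deltaH (p q : ℝ) : ℝ :=
  |p ^ 2 * (1 - 2 * Real.log p) - q ^ 2 * (1 - 2 * Real.log q)| / (2 * (p + q))

/-- dl(p,q) = lit(p,q) - δh(p,q). -/
noncomputable def dl (p q : ℝ) : ℝ := lit p q - deltaH p q

/-- DLITE of two distributions on a finite index set: DL(P,Q) = ∑ i, dl(P i, Q i). -/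
noncomputable def DL {ι : Type*} [Fintype ι] (P Q : ι → ℝ) : ℝ :=
  ∑ i, dl (P i) (Q i)

/-- `IsProbDist P` : nonnegative real entries summing to 1. -/
def IsProbDist {ι : Type*} [Fintype ι] (P : ι → ℝ) : Prop :=
  (∀ i, 0 ≤ P i) ∧ ∑ i, P i = 1

theorem mul_one_sub_log_le {p q : ℝ} (hq : 0 ≤ q) (hqp : q ≤ p) (hp : p ≤ 1) :
    q * (1 - Real.log q) ≤ p * (1 - Real.log p) := by
  rcases hq.eq_or_lt with rfl | hq
  · simpa using mul_nonneg hqp (by linarith [Real.log_nonpos hqp hp])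
  · have hp0 : 0 < p := hq.trans_le hqp
    have h1 : q * (Real.log p - Real.log q) ≤ p - q := by
      have h := Real.log_le_sub_one_of_pos (div_pos hp0 hq)
      rw [Real.log_div hp0.ne' hq.ne'] at h
      calc q * (Real.log p - Real.log q) ≤ q * (p / q - 1) := by gcongr
        _ = p - q := by field_simp
    nlinarith [mul_nonneg (sub_nonneg.2 hqp) (neg_nonneg.2 (Real.log_nonpos hp0.le hp))]

theorem sq_mul_one_sub_two_log_le {p q : ℝ} (hq : 0 ≤ q) (hqp : q ≤ p) (hp : p ≤ 1) :
    q ^ 2 * (1 - 2 * Real.log q) ≤ p ^ 2 * (1 - 2 * Real.log p) := by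
  simpa [Real.log_pow] using mul_one_sub_log_le (sq_nonneg q)
    (pow_le_pow_left₀ hq hqp 2) (pow_le_one₀ (hq.trans hqp) hp)

theorem dl_of_le {p q : ℝ} (hq : 0 ≤ q) (hqp : q ≤ p) (hp : p ≤ 1) :
    dl p q = p * (1 - Real.log p) - q * (1 - Real.log q) -
      (p ^ 2 * (1 - 2 * Real.log p) - q ^ 2 * (1 - 2 * Real.log q)) / (2 * (p + q)) := by
  rw [dl, lit, deltaH, abs_of_nonneg (sub_nonneg.2 (mul_one_sub_log_le hq hqp hp)),
    abs_of_nonneg (sub_nonneg.2 (sq_mul_one_sub_two_log_le hq hqp hp))]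

theorem dl_comm (p q : ℝ) : dl p q = dl q p := by
  simp only [dl, lit, deltaH, add_comm p q]
  rw [abs_sub_comm, abs_sub_comm (p ^ 2 * _)]

/-- On the unit interval, `dl` is positively homogeneous of degree one. -/
theorem dl_mul_right {p q c : ℝ} (hp : 0 ≤ p) (hp1 : p ≤ 1) (hq : 0 ≤ q) (hq1 : q ≤ 1)
    (hc : 0 ≤ c) (hc1 : c ≤ 1) : dl (p * c) (q * c) = dl p q * c := by
  wlog hqp : q ≤ p generalizing p q
  · rw [dl_comm, dl_comm p, this hq hq1 hp hp1 (le_of_not_ge hqp)]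
  rcases hc.eq_or_lt with rfl | hc
  · simp [dl, lit, deltaH]
  rcases hp.eq_or_lt with rfl | hp
  · obtain rfl := le_antisymm hqp hq
    simp [dl, lit, deltaH]
  rw [dl_of_le hq hqp hp1, dl_of_le (by positivity) (by gcongr) (mul_le_one₀ hp1 hc.le hc1),
    Real.log_mul hp.ne' hc.ne']
  rcases hq.eq_or_lt with rfl | hq
  · simp only [zero_mul, add_zero]
    field_simp
    ring
  · rw [Real.log_mul hq.ne' hc.ne']
    field_simp
    ring

theorem IsProbDist.le_one {ι : Type*} [Fintype ι] {P : ι → ℝ} (hP : IsProbDist P) (i : ι) :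
    P i ≤ 1 :=
  hP.2 ▸ Finset.single_le_sum (fun j _ => hP.1 j) (Finset.mem_univ i)

theorem DL_prod_indep {X Y : Type*} [Fintype X] [Fintype Y]
    (PX QX : X → ℝ) (PY : Y → ℝ)
    (hPX : IsProbDist PX) (hQX : IsProbDist QX) (hPY : IsProbDist PY) :
    DL (fun z : X × Y => PX z.1 * PY z.2) (fun z : X × Y => QX z.1 * PY z.2) =
      DL PX QX := by
  simp only [DL]
  rw [Fintype.sum_prod_type]
  refine Finset.sum_congr rfl fun x _ => ?_
  calc ∑ y, dl (PX x * PY y) (QX x * PY y) = ∑ y, dl (PX x) (QX x) * PY y :=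
        Finset.sum_congr rfl fun y _ => dl_mul_right (hPX.1 x) (hPX.le_one x) (hQX.1 x)
          (hQX.le_one x) (hPY.1 y) (hPY.le_one y)
    _ = dl (PX x) (QX x) := by rw [← Finset.mul_sum, hPY.2, mul_one]
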